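/- Let n ≥ 2 be an integer. Every pair (L, k) ∈ (E → ℕ) × ℕ, where L is a magic labeling of G_n with max(L) ≤ k, can be written as a nonnegative integer combination c_1·(L_1, 1) + ⋯ + c_n·(L_n, 1) + c_0·(0⃗, 1) + c_*·(L_*, n−1), where addition is componentwise. -/

import Mathlib

open Finset

/-- Vertices of the graph `G n`: `Sum.inl i` is `aᵢ`, `Sum.inr (Sum.inl i)` is `bᵢ`,
`Sum.inr (Sum.inr false)` is `x`, and `Sum.inr (Sum.inr true)` is `y`. -/
abbrev Vn (n : ℕ) := Fin n ⊕ Fin n ⊕ Bool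

def va {n : ℕ} (i : Fin n) : Vn n := Sum.inl i
def vb {n : ℕ} (i : Fin n) : Vn n := Sum.inr (Sum.inl i)
def vx {n : ℕ} : Vn n := Sum.inr (Sum.inr false)
def vy {n : ℕ} : Vn n := Sum.inr (Sum.inr true)

/-- The edge set of the graph `Gₙ`: edges `aᵢbᵢ`, `x aᵢ` and `y bᵢ` for `1 ≤ i ≤ n`. -/
def Gedges (n : ℕ) : Finset (Sym2 (Vn n)) :=
  (Finset.univ.image fun i : Fin n => s(va i, vb i)) ∪
  (Finset.univ.image fun i : Fin n => s(vx, va i)) ∪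
  (Finset.univ.image fun i : Fin n => s(vy, vb i))

/-- Sum of the labels of the edges incident to `v`. -/
def vsum {V : Type} [DecidableEq V] (E : Finset (Sym2 V)) (L : E → ℕ) (v : V) : ℕ :=
  ∑ e ∈ E.attach, if v ∈ e.1 then L e else 0

/-- A labeling is magic if the label sum is the same at every vertex. -/
def IsMagic {V : Type} [DecidableEq V] (E : Finset (Sym2 V)) (L : E → ℕ) : Prop :=
  ∀ v w : V, vsum E L v = vsum E L w

/-- The perfect matching labeling `Lᵢ`: label `1` on the edges `x aᵢ`, `y bᵢ`, and
`aⱼbⱼ` for `j ≠ i`, and `0` on all other edges. -/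
def Lmatch (n : ℕ) (i : Fin n) : ↥(Gedges n) → ℕ :=
  fun e => if (∃ j, j ≠ i ∧ e.1 = s(va j, vb j)) ∨ e.1 = s(vx, va i) ∨ e.1 = s(vy, vb i)
    then 1 else 0

/-- The labeling `L⁎` assigning `n - 1` to each edge `aᵢbᵢ` and `1` to each edge
`x aᵢ` and `y bᵢ` (the latter being exactly the edges containing `x` or `y`). -/
def Lstar (n : ℕ) : ↥(Gedges n) → ℕ :=
  fun e => if (vx : Vn n) ∈ e.1 ∨ (vy : Vn n) ∈ e.1 then 1 else n - 1

theorem ab_mem_Gedges {n : ℕ} (i : Fin n) : s(va i, vb i) ∈ Gedges n := by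
  simp [Gedges, va, vb, vx, vy]

theorem xa_mem_Gedges {n : ℕ} (i : Fin n) : s(vx, va i) ∈ Gedges n := by
  simp [Gedges, va, vb, vx, vy]

theorem yb_mem_Gedges {n : ℕ} (i : Fin n) : s(vy, vb i) ∈ Gedges n := by
  simp [Gedges, va, vb, vx, vy]

theorem forall_Gedges {n : ℕ} {p : Gedges n → Prop} (hab : ∀ i, p ⟨_, ab_mem_Gedges i⟩)
    (hxa : ∀ i, p ⟨_, xa_mem_Gedges i⟩) (hyb : ∀ i, p ⟨_, yb_mem_Gedges i⟩) (e : Gedges n) :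
    p e := by
  obtain ⟨e, he⟩ := e
  have h := he
  simp only [Gedges, mem_union, mem_image, mem_univ, true_and] at h
  rcases h with (⟨i, rfl⟩ | ⟨i, rfl⟩) | ⟨i, rfl⟩
  exacts [hab i, hxa i, hyb i]

theorem sum_Gedges {n : ℕ} {M : Type*} [AddCommMonoid M] (f : Sym2 (Vn n) → M) :
    ∑ e ∈ Gedges n, f e =
      ∑ i, f s(va i, vb i) + ∑ i, f s(vx, va i) + ∑ i, f s(vy, vb i) := by
  rw [Gedges, sum_union, sum_union, sum_image, sum_image, sum_image]
  · intro i _ j _; simp [vb, vy]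
  · intro i _ j _; simp [va, vx]
  · intro i _ j _; simp [va, vb]
  · simp [disjoint_left, va, vb, vx]
  · simp only [disjoint_left, mem_union, mem_image, mem_univ, true_and]
    rintro _ (⟨i, rfl⟩ | ⟨i, rfl⟩) <;> simp [va, vb, vx, vy]

theorem sum_attach_Gedges {n : ℕ} {M : Type*} [AddCommMonoid M] (f : Gedges n → M) :
    ∑ e ∈ (Gedges n).attach, f e =
      ∑ i, f ⟨_, ab_mem_Gedges i⟩ + ∑ i, f ⟨_, xa_mem_Gedges i⟩ +
        ∑ i, f ⟨_, yb_mem_Gedges i⟩ := by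
  have h := sum_Gedges fun e => if h : e ∈ Gedges n then f ⟨e, h⟩ else 0
  rw [← sum_attach] at h
  simpa [ab_mem_Gedges, xa_mem_Gedges, yb_mem_Gedges] using h

theorem vsum_va {n : ℕ} (L : Gedges n → ℕ) (i : Fin n) :
    vsum (Gedges n) L (va i) = L ⟨_, ab_mem_Gedges i⟩ + L ⟨_, xa_mem_Gedges i⟩ := by
  rw [vsum, sum_attach_Gedges]
  simp [va, vb, vx, vy]

theorem vsum_vb {n : ℕ} (L : Gedges n → ℕ) (i : Fin n) :
    vsum (Gedges n) L (vb i) = L ⟨_, ab_mem_Gedges i⟩ + L ⟨_, yb_mem_Gedges i⟩ := by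
  rw [vsum, sum_attach_Gedges]
  simp [va, vb, vx, vy]

theorem vsum_vx {n : ℕ} (L : Gedges n → ℕ) :
    vsum (Gedges n) L vx = ∑ i, L ⟨_, xa_mem_Gedges i⟩ := by
  rw [vsum, sum_attach_Gedges]
  simp [va, vb, vx, vy]

theorem Lmatch_ab {n : ℕ} (i j : Fin n) :
    Lmatch n i ⟨_, ab_mem_Gedges j⟩ = if j = i then 0 else 1 := by
  simp only [Lmatch]
  by_cases h : j = i <;> simp [va, vb, vx, vy, h]

theorem Lmatch_xa {n : ℕ} (i j : Fin n) :
    Lmatch n i ⟨_, xa_mem_Gedges j⟩ = if j = i then 1 else 0 := by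
  simp [Lmatch, va, vb, vx, vy]

theorem Lmatch_yb {n : ℕ} (i j : Fin n) :
    Lmatch n i ⟨_, yb_mem_Gedges j⟩ = if j = i then 1 else 0 := by
  simp [Lmatch, va, vb, vx, vy]

theorem sum_mul_Lmatch_ab {n : ℕ} (c : Fin n → ℕ) (j : Fin n) :
    ∑ i, c i * Lmatch n i ⟨_, ab_mem_Gedges j⟩ + c j = ∑ i, c i := by
  rw [← add_sum_erase _ c (mem_univ j), add_comm, ← add_sum_erase _ _ (mem_univ j)]
  simp only [Lmatch_ab, if_true, mul_zero, zero_add]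
  congr 1
  refine sum_congr rfl fun i hi => ?_
  rw [if_neg (ne_of_mem_erase hi).symm, mul_one]

/-- Every magic `k`-labeling `(L, k)` of `Gₙ` is a nonnegative integer combination of
`(L₁,1), …, (Lₙ,1)`, `(0,1)`, and `(L⁎, n-1)`. -/
theorem magic_labeling_generators (n : ℕ) (hn : 2 ≤ n)
    (L : ↥(Gedges n) → ℕ) (k : ℕ) (hL : IsMagic (Gedges n) L) (hk : ∀ e, L e ≤ k) :
    ∃ (c : Fin n → ℕ) (c₀ cs : ℕ),
      (∀ e, L e = (∑ i, c i * Lmatch n i e) + cs * Lstar n e) ∧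
      k = (∑ i, c i) + c₀ + cs * (n - 1) := by
  have : NeZero n := ⟨by omega⟩
  obtain ⟨m, -, hm⟩ := exists_min_image univ (fun i => L ⟨_, xa_mem_Gedges i⟩) univ_nonempty
  have ha (i : Fin n) := (vsum_va L i).symm.trans ((hL _ vx).trans (vsum_vx L))
  have hb (i : Fin n) := (vsum_vb L i).symm.trans ((hL _ vx).trans (vsum_vx L))
  set q := L ⟨_, xa_mem_Gedges m⟩
  have hqle (i : Fin n) : q ≤ L ⟨_, xa_mem_Gedges i⟩ := hm i (mem_univ i)
  let c : Fin n → ℕ := fun i => L ⟨_, xa_mem_Gedges i⟩ - q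
  have hc (i : Fin n) : L ⟨_, xa_mem_Gedges i⟩ = c i + q := (Nat.sub_add_cancel (hqle i)).symm
  have hsum : ∑ i, L ⟨_, xa_mem_Gedges i⟩ = ∑ i, c i + q * (n - 1) + q := by
    obtain ⟨r, rfl⟩ : ∃ r, n = r + 1 := ⟨n - 1, by omega⟩
    simp only [hc, sum_add_distrib, sum_const, card_univ, Fintype.card_fin, smul_eq_mul,
      Nat.add_sub_cancel]
    ring
  have hkm := hk ⟨_, ab_mem_Gedges m⟩
  have ham := ha m
  refine ⟨c, k - (∑ i, c i + q * (n - 1)), q, fun e => ?_, by omega⟩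
  refine forall_Gedges (p := fun e => L e = ∑ i, c i * Lmatch n i e + q * Lstar n e)
    (fun i => ?_) (fun i => ?_) (fun i => ?_) e
  · have hstar : Lstar n ⟨_, ab_mem_Gedges i⟩ = n - 1 := by simp [Lstar, va, vb, vx, vy]
    have := sum_mul_Lmatch_ab c i
    have := ha i
    have := hc i
    rw [hstar]
    omega
  · simp [Lmatch_xa, Lstar, hc i]
  · have := ha i
    have := hb i
    have : L ⟨_, yb_mem_Gedges i⟩ = c i + q := by have := hc i; omega
    simp [Lmatch_yb, Lstar, this]
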